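/- arXiv:1202.2727 — 2 statements merged into one kernel-verified Lean document; each statement's English description precedes it below -/
import Mathlib

section
/- The set of I-specific elimination vectors is in general not convex: for n = 1, m = 2 and the ideal I := ⟨x + u + v, x² − 1⟩ ⊆ ℚ[x,u,v], the weight vectors σ = (9,12,0) and τ = (9,0,10) are I-specific elimination vectors for the elimination of {u,v}, but their midpoint ω = (9,6,5) is not an I-specific elimination vector. Hence the union of the Gröbner cones of all I-specific elimination orders is not a convex set. -/
open MvPolynomial

/-- A monomial order on exponent vectors in `Fin N →₀ ℕ`:
a linear order compatible with addition in which `0` is the least element. -/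
structure MonoOrder (N : ℕ) where
  lt : (Fin N →₀ ℕ) → (Fin N →₀ ℕ) → Prop
  total : ∀ a b, a = b ∨ lt a b ∨ lt b a
  trans : ∀ a b c, lt a b → lt b c → lt a c
  irrefl : ∀ a, ¬ lt a a
  add_right : ∀ a b c, lt a b → lt (a + c) (b + c)
  zero_lt : ∀ a, a ≠ 0 → lt 0 a

variable {N : ℕ} {K : Type*} [Field K]

/-- The ω-degree `ω · d` of an exponent vector `d`. -/
noncomputable def wdeg (ω : Fin N → ℝ) (d : Fin N → ℕ) : ℝ :=
  ∑ i, ω i * (d i : ℝ)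

/-- The ≺-maximal exponent in the support of `p` (the exponent of the leading term). -/
noncomputable def leadExp (mo : MonoOrder N) (p : MvPolynomial (Fin N) K) : Fin N →₀ ℕ :=
  open Classical in
  if h : ∃ d ∈ p.support, ∀ e ∈ p.support, e ≠ d → mo.lt e d then h.choose else 0

/-- The leading term `lt_≺(p)` of `p` w.r.t. the monomial order `mo`. -/
noncomputable def leadTerm (mo : MonoOrder N) (p : MvPolynomial (Fin N) K) :
    MvPolynomial (Fin N) K :=
  monomial (leadExp mo p) (p.coeff (leadExp mo p))

/-- `p ∈ K[X]`: the polynomial `p` involves only the first `n` variables. -/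
def inKX (n : ℕ) (p : MvPolynomial (Fin N) K) : Prop :=
  ∀ d ∈ p.support, ∀ i : Fin N, n ≤ (i : ℕ) → d i = 0

open Classical in
/-- Initial form `lt_ω(p)`: the sum of the terms of `p` of maximal ω-degree. -/
noncomputable def initForm (ω : Fin N → ℝ) (p : MvPolynomial (Fin N) K) :
    MvPolynomial (Fin N) K :=
  ∑ d ∈ p.support.filter (fun d : Fin N →₀ ℕ => ∀ e ∈ p.support, wdeg ω ⇑e ≤ wdeg ω ⇑d),
    monomial d (p.coeff d)

/-- The initial ideal `⟨lt_ω(I)⟩` w.r.t. a weight vector ω. -/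
noncomputable def ltIdealW (ω : Fin N → ℝ) (I : Ideal (MvPolynomial (Fin N) K)) :
    Ideal (MvPolynomial (Fin N) K) :=
  Ideal.span (initForm ω '' (I : Set (MvPolynomial (Fin N) K)))

/-- The initial ideal `⟨lt_≺(I)⟩` w.r.t. a monomial order. -/
noncomputable def ltIdealO (mo : MonoOrder N) (I : Ideal (MvPolynomial (Fin N) K)) :
    Ideal (MvPolynomial (Fin N) K) :=
  Ideal.span (leadTerm mo '' (I : Set (MvPolynomial (Fin N) K)))

/-- The Gröbner cone `C_≺(I)`. -/
noncomputable def gCone (mo : MonoOrder N) (I : Ideal (MvPolynomial (Fin N) K)) :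
    Set (Fin N → ℝ) :=
  closure {ω | (∀ i, 0 ≤ ω i) ∧ ltIdealW ω I = ltIdealO mo I}

/-- `G` is the normed reduced Gröbner basis of `I` w.r.t. `mo`. -/
def IsRedGB (mo : MonoOrder N) (I : Ideal (MvPolynomial (Fin N) K))
    (G : Set (MvPolynomial (Fin N) K)) : Prop :=
  G.Finite ∧ G ⊆ (I : Set (MvPolynomial (Fin N) K)) ∧
  Ideal.span (leadTerm mo '' G) = ltIdealO mo I ∧
  (∀ g ∈ G, g ≠ 0 ∧ g.coeff (leadExp mo g) = 1) ∧
  (∀ g ∈ G, ∀ h ∈ G, g ≠ h → ∀ d ∈ h.support, ¬ leadExp mo g ≤ d)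

/-- `mo` is an `I`-specific elimination order for the last variables:
every element of the reduced Gröbner basis whose leading term lies in `K[X]`
lies itself in `K[X]`. -/
def IsEO (n : ℕ) (mo : MonoOrder N) (I : Ideal (MvPolynomial (Fin N) K)) : Prop :=
  ∀ G : Set (MvPolynomial (Fin N) K), IsRedGB mo I G →
    ∀ g ∈ G, inKX n (leadTerm mo g) → inKX n g

/-- `ω` is an `I`-specific elimination vector. -/
def IsEV (n : ℕ) (I : Ideal (MvPolynomial (Fin N) K)) (ω : Fin N → ℝ) : Prop :=
  (∀ i, 0 ≤ ω i) ∧ ∃ mo : MonoOrder N, IsEO n mo I ∧ ω ∈ gCone mo I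

/-- The monomial order `mo` refines the weight vector `ω`. -/
def Refines (mo : MonoOrder N) (ω : Fin N → ℝ) : Prop :=
  ∀ d e : Fin N →₀ ℕ, wdeg ω ⇑d < wdeg ω ⇑e → mo.lt d e

/-- `Ω_u`: the set of weight vectors vanishing on the first `n` coordinates. -/
def OmegaU (n N : ℕ) : Set (Fin N → ℝ) :=
  {ω | (∀ i, 0 ≤ ω i) ∧ ∀ i : Fin N, (i : ℕ) < n → ω i = 0}

/-- `L_{X,≺}(G)`: the elements of `G` whose leading term lies in `K[X]`. -/
def LXset (n : ℕ) (mo : MonoOrder N) (G : Set (MvPolynomial (Fin N) K)) :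
    Set (MvPolynomial (Fin N) K) :=
  {p ∈ G | inKX n (leadTerm mo p)}
lemma castAdd_inj (n m : ℕ) : Function.Injective (Fin.castAdd m : Fin n → Fin (n + m)) := by
  intro a b h
  exact Fin.ext (by simpa using congrArg Fin.val h)

/-- Extend an exponent vector on the first `n` variables to all `n + m` variables. -/
noncomputable def extExp (n m : ℕ) (a : Fin n →₀ ℕ) : Fin (n + m) →₀ ℕ :=
  Finsupp.mapDomain (Fin.castAdd m) a

/-- The restriction of a monomial order on `K[X][U]` to the monomials of `K[X]`. -/
noncomputable def restrictOrder (n m : ℕ) (mo : MonoOrder (n + m)) : MonoOrder n where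
  lt a b := mo.lt (extExp n m a) (extExp n m b)
  total a b := by
    rcases mo.total (extExp n m a) (extExp n m b) with h | h | h
    · exact Or.inl (Finsupp.mapDomain_injective (castAdd_inj n m) h)
    · exact Or.inr (Or.inl h)
    · exact Or.inr (Or.inr h)
  trans a b c hab hbc := mo.trans _ _ _ hab hbc
  irrefl a := mo.irrefl _
  add_right a b c h := by
    show mo.lt (extExp n m (a + c)) (extExp n m (b + c))
    rw [show extExp n m (a + c) = extExp n m a + extExp n m c from Finsupp.mapDomain_add,
        show extExp n m (b + c) = extExp n m b + extExp n m c from Finsupp.mapDomain_add]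
    exact mo.add_right _ _ _ h
  zero_lt a ha := by
    show mo.lt (extExp n m 0) (extExp n m a)
    have h0 : extExp n m (0 : Fin n →₀ ℕ) = 0 := Finsupp.mapDomain_zero
    rw [h0]
    refine mo.zero_lt _ (fun h => ha ?_)
    exact Finsupp.mapDomain_injective (castAdd_inj n m) (h.trans h0.symm)

/-- The projection `K[X][U] → K[X]` sending each `u`-variable to `0`;
on polynomials of `K[X]` it inverts the canonical inclusion `K[X] → K[X][U]`. -/
noncomputable def projX (n m : ℕ) (K : Type*) [Field K] :
    MvPolynomial (Fin (n + m)) K →ₐ[K] MvPolynomial (Fin n) K :=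
  aeval (fun i : Fin (n + m) => if h : (i : ℕ) < n then X ⟨(i : ℕ), h⟩ else 0)

/-- The elimination ideal `I ∩ K[X]`, viewed as an ideal of `K[x_1,…,x_n]` via the
canonical inclusion `K[X] → K[X][U]`. -/
noncomputable def elimIdeal (n m : ℕ) {K : Type*} [Field K]
    (I : Ideal (MvPolynomial (Fin (n + m)) K)) : Ideal (MvPolynomial (Fin n) K) :=
  Ideal.comap
    (rename (Fin.castAdd m) : MvPolynomial (Fin n) K →ₐ[K] MvPolynomial (Fin (n + m)) K) I

/-- Priority of the variables for the lex order `u_1 ≻ … ≻ u_m ≻ x_1 ≻ … ≻ x_n`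
(smaller priority value = more significant variable). -/
def uPrio (n m : ℕ) (i : Fin (n + m)) : ℕ :=
  if (i : ℕ) < n then m + (i : ℕ) else (i : ℕ) - n

/-- The pure lexicographic order with `u_1 ≻ … ≻ u_m ≻ x_1 ≻ … ≻ x_n`:
`a <_lex b` iff at the most significant position where they differ, `a` is smaller. -/
def uLexLt (n m : ℕ) (a b : Fin (n + m) →₀ ℕ) : Prop :=
  ∃ i : Fin (n + m), a i < b i ∧ ∀ j : Fin (n + m), uPrio n m j < uPrio n m i → a j = b j
/-- A total preorder on exponent vectors that is invariant under translation. -/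
structure TransPreorder (R : (Fin N →₀ ℕ) → (Fin N →₀ ℕ) → Prop) : Prop where
  total : ∀ a b, R a b ∨ R b a
  trans : ∀ a b c, R a b → R b c → R a c
  add_iff : ∀ a b c, R (a + c) (b + c) ↔ R a b

/-- `d` is the unique `R`-maximal exponent of `g`. -/
def IsStrictMax (R : (Fin N →₀ ℕ) → (Fin N →₀ ℕ) → Prop) (g : MvPolynomial (Fin N) K)
    (d : Fin N →₀ ℕ) : Prop :=
  d ∈ g.support ∧ ∀ e ∈ g.support, e ≠ d → ¬ R d e

section TransPreorder

variable {R : (Fin N →₀ ℕ) → (Fin N →₀ ℕ) → Prop}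

lemma TransPreorder.refl (hR : TransPreorder R) (a : Fin N →₀ ℕ) : R a a :=
  (hR.total a a).elim id id

lemma TransPreorder.exists_max (hR : TransPreorder R) {s : Finset (Fin N →₀ ℕ)}
    (hs : s.Nonempty) : ∃ d ∈ s, ∀ e ∈ s, R e d := by
  classical
  induction hs using Finset.Nonempty.cons_induction with
  | singleton a => exact ⟨a, by simp, by simpa using hR.refl a⟩
  | cons a s ha hs ih =>
    obtain ⟨d, hd, hmax⟩ := ih
    rcases hR.total a d with h | h
    · refine ⟨d, by simp [hd], fun e he => ?_⟩
      rcases Finset.mem_cons.1 he with rfl | he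
      exacts [h, hmax e he]
    · refine ⟨a, by simp, fun e he => ?_⟩
      rcases Finset.mem_cons.1 he with rfl | he
      exacts [hR.refl _, hR.trans _ _ _ (hmax e he) h]

lemma IsStrictMax.le (hR : TransPreorder R) {g : MvPolynomial (Fin N) K} {d e : Fin N →₀ ℕ}
    (h : IsStrictMax R g d) (he : e ∈ g.support) : R e d := by
  by_cases hed : e = d
  · exact hed ▸ hR.refl e
  · exact (hR.total e d).resolve_right (h.2 e he hed)

lemma IsStrictMax.exists_eq_add_of_mem_support_mul (hR : TransPreorder R)
    {g A : MvPolynomial (Fin N) K} {d₁ d : Fin N →₀ ℕ} (h : IsStrictMax R g d₁)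
    (hd : d ∈ (A * g).support) (hmax : ∀ m ∈ A.support, R (m + d₁) d) :
    ∃ m, d = m + d₁ := by
  classical
  obtain ⟨m, hm, e, he, rfl⟩ := Finset.mem_add.1 (support_mul A g hd)
  refine ⟨m, ?_⟩
  by_contra hne
  refine h.2 e he (fun h' => hne (by rw [h'])) ?_
  have := hmax m hm
  rwa [add_comm m, add_comm m, hR.add_iff] at this

lemma IsStrictMax.add_mem_support_mul (hR : TransPreorder R)
    {g A : MvPolynomial (Fin N) K} {d₁ m : Fin N →₀ ℕ} (h : IsStrictMax R g d₁)
    (hm : m ∈ A.support) (hmax : ∀ e ∈ A.support, R e m) :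
    m + d₁ ∈ (A * g).support := by
  classical
  rw [mem_support_iff, coeff_mul, Finset.sum_eq_single (m, d₁)]
  · exact mul_ne_zero (mem_support_iff.1 hm) (mem_support_iff.1 h.1)
  · rintro ⟨m', e⟩ hsum hne
    rw [Finset.HasAntidiagonal.mem_antidiagonal] at hsum
    dsimp only at hsum ⊢
    by_contra hcoeff
    have hm' := hmax m' (mem_support_iff.2 (left_ne_zero_of_mul hcoeff))
    have he : e ∈ g.support := mem_support_iff.2 (right_ne_zero_of_mul hcoeff)
    refine h.2 e he (fun h' => hne ?_) ?_
    · subst h'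
      rw [add_right_cancel hsum]
    · rw [← hR.add_iff _ _ m, add_comm d₁, ← hsum, add_comm m' e, add_comm e m', add_comm e m,
        hR.add_iff]
      exact hm'
  · intro hn
    exact absurd (by rw [Finset.HasAntidiagonal.mem_antidiagonal]) hn

lemma exists_reduction {a : Fin N} {g : MvPolynomial (Fin N) K}
    (hg : ∀ d ∈ (X a - g).support, d a = 0) (B : MvPolynomial (Fin N) K) :
    ∃ B' C : MvPolynomial (Fin N) K, B = B' + C * g ∧ ∀ d ∈ B'.support, d a = 0 := by
  classical
  induction B using MvPolynomial.induction_on with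
  | C c =>
    refine ⟨C c, 0, by simp, fun d hd => ?_⟩
    rw [mem_support_iff, coeff_C] at hd
    obtain rfl : 0 = d := by by_contra h; simp [h] at hd
    rfl
  | add p q hp hq =>
    obtain ⟨p', c, hp, hp'⟩ := hp
    obtain ⟨q', c', hq, hq'⟩ := hq
    refine ⟨p' + q', c + c', by rw [hp, hq]; ring, fun d hd => ?_⟩
    rcases Finset.mem_union.1 (support_add hd) with h | h
    exacts [hp' d h, hq' d h]
  | mul_X p i hp =>
    obtain ⟨p', c, hp, hp'⟩ := hp
    by_cases hi : i = a
    · subst hi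
      refine ⟨p' * (X i - g), c * X i + p', by rw [hp]; ring, fun d hd => ?_⟩
      obtain ⟨m, hm, e, he, rfl⟩ := Finset.mem_add.1 (support_mul _ _ hd)
      simp [hp' m hm, hg e he]
    · refine ⟨p' * X i, c * X i, by rw [hp]; ring, fun d hd => ?_⟩
      obtain ⟨m, hm, e, he, rfl⟩ := Finset.mem_add.1 (support_mul _ _ hd)
      rw [support_X, Finset.mem_singleton] at he
      simp [hp' m hm, he, hi]

/-- The two generators have coprime leading monomials, the first one a variable `X a` that does
not occur in the second, so the leading exponents of the ideal are the multiples of theirs. -/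
lemma le_of_max_of_mem_span_pair (hR : TransPreorder R) {a : Fin N}
    {g₁ g₂ : MvPolynomial (Fin N) K} {d₂ : Fin N →₀ ℕ}
    (h₁ : IsStrictMax R g₁ (Finsupp.single a 1)) (h₂ : IsStrictMax R g₂ d₂)
    (hg₁ : ∀ d ∈ (X a - g₁).support, d a = 0) (hg₂ : ∀ d ∈ g₂.support, d a = 0)
    {f : MvPolynomial (Fin N) K} (hf : f ∈ Ideal.span {g₁, g₂}) {d : Fin N →₀ ℕ}
    (hd : d ∈ f.support) (hmax : ∀ e ∈ f.support, R e d) :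
    Finsupp.single a 1 ≤ d ∨ d₂ ≤ d := by
  classical
  obtain ⟨A₀, B₀, rfl⟩ := Ideal.mem_span_pair.1 hf
  obtain ⟨B, C, rfl, hB⟩ := exists_reduction hg₁ B₀
  obtain ⟨A, hA⟩ : ∃ A, A₀ * g₁ + (B + C * g₁) * g₂ = A * g₁ + B * g₂ :=
    ⟨A₀ + C * g₂, by ring⟩
  rw [hA] at hd hmax
  have hBg : ∀ e ∈ (B * g₂).support, e a = 0 := by
    intro e he
    obtain ⟨m, hm, k, hk, rfl⟩ := Finset.mem_add.1 (support_mul _ _ he)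
    simp [hB m hm, hg₂ k hk]
  have hdA : ∀ m ∈ A.support, R (m + Finsupp.single a 1) d := by
    intro m hm
    obtain ⟨m', hm', hmax'⟩ := hR.exists_max ⟨m, hm⟩
    refine hR.trans _ _ _ ((hR.add_iff _ _ _).2 (hmax' m hm)) (hmax _ ?_)
    have h0 : coeff (m' + Finsupp.single a 1) (B * g₂) = 0 := by
      by_contra h
      simpa using hBg _ (mem_support_iff.2 h)
    rw [mem_support_iff, coeff_add, h0, add_zero, ← mem_support_iff]
    exact h₁.add_mem_support_mul hR hm' hmax'
  have hAg : ∀ e ∈ (A * g₁).support, R e d := by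
    intro e he
    obtain ⟨m, hm, k, hk, rfl⟩ := Finset.mem_add.1 (support_mul _ _ he)
    refine hR.trans _ _ _ ?_ (hdA m hm)
    rw [add_comm m, add_comm m, hR.add_iff]
    exact h₁.le hR hk
  have hdB : ∀ m ∈ B.support, R (m + d₂) d := by
    intro m hm
    obtain ⟨m', hm', hmax'⟩ := hR.exists_max ⟨m, hm⟩
    refine hR.trans _ _ _ ((hR.add_iff _ _ _).2 (hmax' m hm)) ?_
    by_cases h0 : m' + d₂ ∈ (A * g₁).support
    · exact hAg _ h0
    · refine hmax _ ?_
      rw [mem_support_iff, coeff_add, notMem_support_iff.1 h0, zero_add, ← mem_support_iff]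
      exact h₂.add_mem_support_mul hR hm' hmax'
  rcases Finset.mem_union.1 (support_add hd) with h | h
  · obtain ⟨m, rfl⟩ := h₁.exists_eq_add_of_mem_support_mul hR h hdA
    exact Or.inl le_add_self
  · obtain ⟨m, rfl⟩ := h₂.exists_eq_add_of_mem_support_mul hR h hdB
    exact Or.inr le_add_self

end TransPreorder

lemma MonoOrder.asymm (mo : MonoOrder N) {a b : Fin N →₀ ℕ} (h : mo.lt a b) : ¬ mo.lt b a :=
  fun h' => mo.irrefl _ (mo.trans _ _ _ h h')

lemma MonoOrder.transPreorder (mo : MonoOrder N) : TransPreorder fun a b => ¬ mo.lt b a where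
  total a b := by
    by_contra! h
    exact mo.asymm h.1 h.2
  trans a b c hab hbc hca := by
    rcases mo.total b c with rfl | h | h
    · exact hab hca
    · exact hab (mo.trans _ _ _ h hca)
    · exact hbc h
  add_iff a b c := by
    refine not_congr ⟨fun h => ?_, mo.add_right _ _ _⟩
    rcases mo.total b a with rfl | h' | h'
    · exact absurd h (mo.irrefl _)
    · exact h'
    · exact absurd (mo.add_right _ _ c h') (mo.asymm h)

lemma wdeg_transPreorder (ω : Fin N → ℝ) :
    TransPreorder fun a b : Fin N →₀ ℕ => wdeg ω ⇑a ≤ wdeg ω ⇑b where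
  total _ _ := le_total _ _
  trans _ _ _ := le_trans
  add_iff a b c := by simp [wdeg, mul_add, Finset.sum_add_distrib]

lemma leadExp_eq (mo : MonoOrder N) {g : MvPolynomial (Fin N) K} {d : Fin N →₀ ℕ}
    (hd : IsStrictMax (fun a b => ¬ mo.lt b a) g d) : leadExp mo g = d := by
  have h : ∃ d ∈ g.support, ∀ e ∈ g.support, e ≠ d → mo.lt e d :=
    ⟨d, hd.1, fun e he hne => not_not.1 (hd.2 e he hne)⟩
  rw [leadExp, dif_pos h]
  by_contra hne
  exact hd.2 _ h.choose_spec.1 hne (mo.asymm (h.choose_spec.2 d hd.1 (Ne.symm hne)))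

lemma isStrictMax_leadExp (mo : MonoOrder N) {g : MvPolynomial (Fin N) K} (hg : g ≠ 0) :
    IsStrictMax (fun a b => ¬ mo.lt b a) g (leadExp mo g) := by
  obtain ⟨d, hd, hmax⟩ := mo.transPreorder.exists_max (support_nonempty.2 hg)
  have h : IsStrictMax (fun a b => ¬ mo.lt b a) g d :=
    ⟨hd, fun e he hne => not_not.2
      (((mo.total e d).resolve_left hne).resolve_right (hmax e he))⟩
  rwa [leadExp_eq mo h]

lemma initForm_eq {ω : Fin N → ℝ} {g : MvPolynomial (Fin N) K} {d : Fin N →₀ ℕ}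
    (hd : IsStrictMax (fun a b : Fin N →₀ ℕ => wdeg ω ⇑a ≤ wdeg ω ⇑b) g d) :
    initForm ω g = monomial d (g.coeff d) := by
  classical
  rw [initForm, Finset.sum_eq_single d]
  · intro e he hne
    rw [Finset.mem_filter] at he
    exact absurd (he.2 d hd.1) (hd.2 e he.1 hne)
  · intro h
    refine absurd (Finset.mem_filter.2 ⟨hd.1, fun e he => ?_⟩) h
    exact hd.le (wdeg_transPreorder ω) he

lemma monomial_mem_span_pair {d d₁ d₂ : Fin N →₀ ℕ} (c : K) (h : d₁ ≤ d ∨ d₂ ≤ d) :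
    monomial d c ∈ Ideal.span {monomial d₁ (1 : K), monomial d₂ 1} := by
  rcases h with h | h
  · rw [← tsub_add_cancel_of_le h, ← mul_one c, ← monomial_mul]
    exact Ideal.mul_mem_left _ _ (Ideal.subset_span (by simp))
  · rw [← tsub_add_cancel_of_le h, ← mul_one c, ← monomial_mul]
    exact Ideal.mul_mem_left _ _ (Ideal.subset_span (by simp))

section SpanPair

variable {a : Fin N} {g₁ g₂ : MvPolynomial (Fin N) K} {d₂ : Fin N →₀ ℕ}

lemma ltIdealO_span_pair {mo : MonoOrder N}
    (h₁ : IsStrictMax (fun a b => ¬ mo.lt b a) g₁ (Finsupp.single a 1))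
    (h₂ : IsStrictMax (fun a b => ¬ mo.lt b a) g₂ d₂)
    (hc₁ : coeff (Finsupp.single a 1) g₁ = 1) (hc₂ : coeff d₂ g₂ = 1)
    (hg₁ : ∀ d ∈ (X a - g₁).support, d a = 0) (hg₂ : ∀ d ∈ g₂.support, d a = 0) :
    ltIdealO mo (Ideal.span {g₁, g₂}) =
      Ideal.span {monomial (Finsupp.single a 1) 1, monomial d₂ 1} := by
  apply le_antisymm
  · refine Ideal.span_le.2 ?_
    rintro _ ⟨f, hf, rfl⟩
    by_cases h0 : f = 0
    · simp [h0, leadTerm]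
    · have h := isStrictMax_leadExp mo h0
      exact monomial_mem_span_pair _ (le_of_max_of_mem_span_pair mo.transPreorder h₁ h₂ hg₁ hg₂
        hf h.1 fun e he => h.le mo.transPreorder he)
  · refine Ideal.span_mono ?_
    rintro _ (rfl | rfl)
    · exact ⟨g₁, Ideal.subset_span (by simp), by rw [leadTerm, leadExp_eq mo h₁, hc₁]⟩
    · exact ⟨g₂, Ideal.subset_span (by simp), by rw [leadTerm, leadExp_eq mo h₂, hc₂]⟩

lemma ltIdealW_span_pair {ω : Fin N → ℝ}
    (h₁ : IsStrictMax (fun a b : Fin N →₀ ℕ => wdeg ω ⇑a ≤ wdeg ω ⇑b) g₁ (Finsupp.single a 1))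
    (h₂ : IsStrictMax (fun a b : Fin N →₀ ℕ => wdeg ω ⇑a ≤ wdeg ω ⇑b) g₂ d₂)
    (hc₁ : coeff (Finsupp.single a 1) g₁ = 1) (hc₂ : coeff d₂ g₂ = 1)
    (hg₁ : ∀ d ∈ (X a - g₁).support, d a = 0) (hg₂ : ∀ d ∈ g₂.support, d a = 0) :
    ltIdealW ω (Ideal.span {g₁, g₂}) =
      Ideal.span {monomial (Finsupp.single a 1) 1, monomial d₂ 1} := by
  classical
  apply le_antisymm
  · refine Ideal.span_le.2 ?_
    rintro _ ⟨f, hf, rfl⟩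
    refine Ideal.sum_mem _ fun d hd => ?_
    rw [Finset.mem_filter] at hd
    exact monomial_mem_span_pair _ (le_of_max_of_mem_span_pair (wdeg_transPreorder ω) h₁ h₂
      hg₁ hg₂ hf hd.1 hd.2)
  · refine Ideal.span_mono ?_
    rintro _ (rfl | rfl)
    · exact ⟨g₁, Ideal.subset_span (by simp), by rw [initForm_eq h₁, hc₁]⟩
    · exact ⟨g₂, Ideal.subset_span (by simp), by rw [initForm_eq h₂, hc₂]⟩

end SpanPair

/-- The linear generator `x + u + v`. -/
noncomputable def linGen : MvPolynomial (Fin (1 + 2)) ℚ := X 0 + X 1 + X 2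

lemma coeff_linGen (e : Fin (1 + 2) →₀ ℕ) :
    coeff e linGen = ∑ i, if Finsupp.single i 1 = e then 1 else 0 := by
  rw [linGen, coeff_add, coeff_add, coeff_X, coeff_X, coeff_X]
  exact (Fin.sum_univ_three fun i : Fin 3 => if Finsupp.single i 1 = e then (1 : ℚ) else 0).symm

lemma coeff_single_linGen (i : Fin (1 + 2)) : coeff (Finsupp.single i 1) linGen = 1 := by
  simp [coeff_linGen, Finsupp.single_left_inj]

lemma exists_of_mem_support_linGen {e : Fin (1 + 2) →₀ ℕ} (he : e ∈ linGen.support) :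
    ∃ i, e = Finsupp.single i 1 := by
  by_contra! h
  simp [coeff_linGen, fun i => (h i).symm] at he

lemma linGen_isStrictMax {R : (Fin (1 + 2) →₀ ℕ) → (Fin (1 + 2) →₀ ℕ) → Prop} {i : Fin (1 + 2)}
    (h : ∀ j, j ≠ i → ¬ R (Finsupp.single i 1) (Finsupp.single j 1)) :
    IsStrictMax R linGen (Finsupp.single i 1) := by
  refine ⟨by simp [coeff_single_linGen], fun e he hne => ?_⟩
  obtain ⟨j, rfl⟩ := exists_of_mem_support_linGen he
  exact h j fun hj => hne (by rw [hj])

lemma X_sub_linGen (a : Fin (1 + 2)) : ∀ d ∈ (X a - linGen).support, d a = 0 := by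
  classical
  intro d hd
  obtain ⟨i, rfl⟩ : ∃ i, d = Finsupp.single i 1 := by
    rcases Finset.mem_union.1 (support_sub _ _ _ hd) with h | h
    · exact ⟨a, by simpa only [support_X, Finset.mem_singleton] using h⟩
    · exact exists_of_mem_support_linGen h
  have hi : i ≠ a := by
    rintro rfl
    simp [coeff_single_linGen] at hd
  simp [hi]

lemma coeff_sq_sub_one (e : Fin (1 + 2) →₀ ℕ) (i : Fin (1 + 2)) :
    coeff e (X i ^ 2 - 1 : MvPolynomial (Fin (1 + 2)) ℚ) =
      (if Finsupp.single i 2 = e then 1 else 0) - if 0 = e then 1 else 0 := by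
  classical
  rw [coeff_sub, coeff_X_pow, coeff_one]

lemma of_mem_support_sq_sub_one {e : Fin (1 + 2) →₀ ℕ} {i : Fin (1 + 2)}
    (he : e ∈ (X i ^ 2 - 1 : MvPolynomial (Fin (1 + 2)) ℚ).support) :
    e = Finsupp.single i 2 ∨ e = 0 := by
  by_contra! h
  rw [mem_support_iff, coeff_sq_sub_one] at he
  simp [h.1.symm, h.2.symm] at he

lemma coeff_single_sq_sub_one (i : Fin (1 + 2)) :
    coeff (Finsupp.single i 2) (X i ^ 2 - 1 : MvPolynomial (Fin (1 + 2)) ℚ) = 1 := by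
  rw [coeff_sq_sub_one]
  simp [eq_comm (a := (0 : Fin (1 + 2) →₀ ℕ))]

lemma sq_sub_one_isStrictMax {R : (Fin (1 + 2) →₀ ℕ) → (Fin (1 + 2) →₀ ℕ) → Prop}
    {i : Fin (1 + 2)} (h : ¬ R (Finsupp.single i 2) 0) :
    IsStrictMax R (X i ^ 2 - 1 : MvPolynomial (Fin (1 + 2)) ℚ) (Finsupp.single i 2) := by
  refine ⟨by rw [mem_support_iff, coeff_single_sq_sub_one]; exact one_ne_zero, fun e he hne => ?_⟩
  rwa [(of_mem_support_sq_sub_one he).resolve_left hne]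

lemma sq_sub_one_apply_eq_zero {i a : Fin (1 + 2)} (h : a ≠ i) :
    ∀ d ∈ (X i ^ 2 - 1 : MvPolynomial (Fin (1 + 2)) ℚ).support, d a = 0 := by
  intro d hd
  rcases of_mem_support_sq_sub_one hd with rfl | rfl <;> simp [h.symm]

section AddSq

variable {b c : Fin (1 + 2)}

lemma coeff_add_sq_sub_one (b c : Fin (1 + 2)) (e : Fin (1 + 2) →₀ ℕ) :
    coeff e ((X b + X c) ^ 2 - 1 : MvPolynomial (Fin (1 + 2)) ℚ) =
      (if Finsupp.single b 2 = e then 1 else 0) +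
        (if Finsupp.single b 1 + Finsupp.single c 1 = e then 2 else 0) +
        (if Finsupp.single c 2 = e then 1 else 0) - if 0 = e then 1 else 0 := by
  classical
  have h : ((X b + X c) ^ 2 - 1 : MvPolynomial (Fin (1 + 2)) ℚ) =
      X b ^ 2 + monomial (Finsupp.single b 1 + Finsupp.single c 1) 2 + X c ^ 2 - 1 := by
    have h2 : (monomial (Finsupp.single b 1 + Finsupp.single c 1) 2 :
        MvPolynomial (Fin (1 + 2)) ℚ) = 2 * (X b * X c) := by
      rw [X, X, monomial_mul, ← map_ofNat C 2, C_mul_monomial]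
      norm_num
    rw [h2]
    ring
  rw [h, coeff_sub, coeff_add, coeff_add, coeff_X_pow, coeff_X_pow, coeff_one, coeff_monomial]

lemma of_mem_support_add_sq_sub_one {e : Fin (1 + 2) →₀ ℕ}
    (he : e ∈ ((X b + X c) ^ 2 - 1 : MvPolynomial (Fin (1 + 2)) ℚ).support) :
    e = Finsupp.single b 2 ∨ e = Finsupp.single b 1 + Finsupp.single c 1 ∨
      e = Finsupp.single c 2 ∨ e = 0 := by
  by_contra! h
  rw [mem_support_iff, coeff_add_sq_sub_one] at he
  simp [h.1.symm, h.2.1.symm, h.2.2.1.symm, h.2.2.2.symm] at he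

lemma coeff_single_add_sq_sub_one (h : b ≠ c) :
    coeff (Finsupp.single b 2) ((X b + X c) ^ 2 - 1 : MvPolynomial (Fin (1 + 2)) ℚ) = 1 := by
  have h₁ : Finsupp.single b 1 + Finsupp.single c 1 ≠ Finsupp.single b 2 := fun h' => by
    simpa [h, h.symm] using DFunLike.congr_fun h' c
  have h₂ : Finsupp.single c 2 ≠ Finsupp.single b 2 := fun h' => by
    simpa [h, h.symm] using DFunLike.congr_fun h' c
  have h₃ : 0 ≠ Finsupp.single b 2 := fun h' => by
    simpa using DFunLike.congr_fun h' b
  rw [coeff_add_sq_sub_one]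
  simp [h₁, h₂, h₃]

lemma add_sq_sub_one_isStrictMax (mo : MonoOrder (1 + 2)) (h : b ≠ c)
    (hlt : mo.lt (Finsupp.single c 1) (Finsupp.single b 1)) :
    IsStrictMax (fun a b => ¬ mo.lt b a) ((X b + X c) ^ 2 - 1 : MvPolynomial (Fin (1 + 2)) ℚ)
      (Finsupp.single b 2) := by
  refine ⟨by rw [mem_support_iff, coeff_single_add_sq_sub_one h]; exact one_ne_zero,
    fun e he hne => not_not.2 ?_⟩
  have hb : (Finsupp.single b 2 : Fin (1 + 2) →₀ ℕ) =
      Finsupp.single b 1 + Finsupp.single b 1 := by rw [← Finsupp.single_add]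
  have hc : (Finsupp.single c 2 : Fin (1 + 2) →₀ ℕ) =
      Finsupp.single c 1 + Finsupp.single c 1 := by rw [← Finsupp.single_add]
  have hbc : mo.lt (Finsupp.single b 1 + Finsupp.single c 1) (Finsupp.single b 2) := by
    rw [hb, add_comm (Finsupp.single b 1) (Finsupp.single c 1)]
    exact mo.add_right _ _ _ hlt
  rcases of_mem_support_add_sq_sub_one he with rfl | rfl | rfl | rfl
  · exact absurd rfl hne
  · exact hbc
  · refine mo.trans _ _ _ ?_ hbc
    rw [hc]
    exact mo.add_right _ _ _ hlt
  · exact mo.zero_lt _ (by simp)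

end AddSq

/-- The lexicographic order with `u_i ≻ u_j ≻ u_k`, all variables being listed. -/
def lexOrder (i j k : Fin (1 + 2)) (h : ∀ l, l = i ∨ l = j ∨ l = k) : MonoOrder (1 + 2) where
  lt a b := a i < b i ∨ a i = b i ∧ (a j < b j ∨ a j = b j ∧ a k < b k)
  total a b := by
    have hext : a i = b i → a j = b j → a k = b k → a = b := fun h₁ h₂ h₃ => by
      ext l
      rcases h l with rfl | rfl | rfl <;> assumption
    by_cases hab : a = b
    · exact Or.inl hab
    · have : ¬ (a i = b i ∧ a j = b j ∧ a k = b k) := fun h => hab (hext h.1 h.2.1 h.2.2)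
      omega
  trans a b c := by omega
  irrefl a := by omega
  add_right a b c := by
    simp only [Finsupp.add_apply]
    omega
  zero_lt a ha := by
    simp only [Finsupp.zero_apply]
    by_contra hlt
    refine ha ?_
    ext l
    rw [Finsupp.zero_apply]
    rcases h l with rfl | rfl | rfl <;> omega

lemma lexOrder_lt {i j k : Fin (1 + 2)} {h : ∀ l, l = i ∨ l = j ∨ l = k}
    {a b : Fin (1 + 2) →₀ ℕ} : (lexOrder i j k h).lt a b ↔
      a i < b i ∨ a i = b i ∧ (a j < b j ∨ a j = b j ∧ a k < b k) :=
  Iff.rfl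

lemma inKX_leadTerm_iff {n : ℕ} {mo : MonoOrder N} {g : MvPolynomial (Fin N) K} (hg : g ≠ 0) :
    inKX n (leadTerm mo g) ↔ ∀ i : Fin N, n ≤ (i : ℕ) → leadExp mo g i = 0 := by
  classical
  have := mem_support_iff.1 (isStrictMax_leadExp mo hg).1
  simp [inKX, leadTerm, support_monomial, this]

lemma one_le_val {i : Fin (1 + 2)} (hi : i ≠ 0) : 1 ≤ (i : ℕ) :=
  Nat.one_le_iff_ne_zero.2 fun h => hi (Fin.ext h)

lemma lexOrder_isEO {b c : Fin (1 + 2)} (h : ∀ l, l = b ∨ l = c ∨ l = 0) (hb : b ≠ 0)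
    (hc : c ≠ 0) (I : Ideal (MvPolynomial (Fin (1 + 2)) ℚ)) :
    IsEO 1 (lexOrder b c 0 h) I := by
  intro G hG g hg hlead d hd i hi
  have hg0 := (hG.2.2.2.1 g hg).1
  rw [inKX_leadTerm_iff hg0] at hlead
  by_cases hne : d = leadExp (lexOrder b c 0 h) g
  · exact hne ▸ hlead i hi
  have hlt := not_not.1 ((isStrictMax_leadExp (lexOrder b c 0 h) hg0).2 d hd hne)
  rw [lexOrder_lt, hlead b (one_le_val hb),
    hlead c (one_le_val hc)] at hlt
  rcases h i with rfl | rfl | rfl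
  · omega
  · omega
  · simp at hi

@[simp]
lemma wdeg_single (ω : Fin N → ℝ) (i : Fin N) (k : ℕ) :
    wdeg ω ⇑(Finsupp.single i k : Fin N →₀ ℕ) = ω i * k := by
  rw [wdeg, Finset.sum_eq_single i] <;> simp +contextual [eq_comm]

lemma isEV_of_lt {b c : Fin (1 + 2)} (h : ∀ l, l = b ∨ l = c ∨ l = 0) (hb : b ≠ 0)
    (hc : c ≠ 0) {ω : Fin (1 + 2) → ℝ} (hω : ∀ i, 0 ≤ ω i) (h0 : 0 < ω 0)
    (h0b : ω 0 < ω b) (hcb : ω c < ω b) :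
    IsEV 1 (Ideal.span {linGen, X 0 ^ 2 - 1}) ω := by
  refine ⟨hω, lexOrder b c 0 h, lexOrder_isEO h hb hc _, subset_closure ⟨hω, ?_⟩⟩
  rw [ltIdealW_span_pair (linGen_isStrictMax (i := b) ?_) (sq_sub_one_isStrictMax ?_)
    (coeff_single_linGen b) (coeff_single_sq_sub_one 0) (X_sub_linGen b)
    (sq_sub_one_apply_eq_zero hb),
    ltIdealO_span_pair (linGen_isStrictMax (i := b) ?_) (sq_sub_one_isStrictMax ?_)
    (coeff_single_linGen b) (coeff_single_sq_sub_one 0) (X_sub_linGen b)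
    (sq_sub_one_apply_eq_zero hb)]
  · intro j hj
    rw [not_not, lexOrder_lt]
    simp [hj]
  · exact not_not.2 (MonoOrder.zero_lt _ _ (by simp))
  · intro j hj
    rcases h j with rfl | rfl | rfl
    · exact absurd rfl hj
    · simpa using hcb
    · simpa using h0b
  · rw [wdeg_single, not_le]
    simpa [wdeg] using h0

lemma span_linGen_sq (b c : Fin (1 + 2)) (h : linGen = X 0 + X b + X c) :
    Ideal.span {linGen, (X 0 ^ 2 - 1 : MvPolynomial (Fin (1 + 2)) ℚ)} =
      Ideal.span {linGen, (X b + X c) ^ 2 - 1} := by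
  have hkey : (X 0 ^ 2 - 1 : MvPolynomial (Fin (1 + 2)) ℚ) =
      ((X b + X c) ^ 2 - 1) + (X 0 - X b - X c) * linGen := by rw [h]; ring
  rw [hkey]
  exact Ideal.span_pair_add_mul_left _ _ _

lemma not_isEO_of_lt {mo : MonoOrder (1 + 2)} {b c : Fin (1 + 2)}
    (h : ∀ l, l = b ∨ l = c ∨ l = 0) (hb : b ≠ 0)
    (hc : c ≠ 0) (hbc : b ≠ c) (hlin : linGen = X 0 + X b + X c)
    (hb0 : mo.lt (Finsupp.single b 1) (Finsupp.single 0 1))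
    (hcb : mo.lt (Finsupp.single c 1) (Finsupp.single b 1)) :
    ¬ IsEO 1 mo (Ideal.span {linGen, X 0 ^ 2 - 1}) := by
  intro hEO
  rw [span_linGen_sq b c hlin] at hEO
  have h₁ : IsStrictMax (fun a b => ¬ mo.lt b a) linGen (Finsupp.single 0 1) := by
    refine linGen_isStrictMax fun j hj => not_not.2 ?_
    rcases h j with rfl | rfl | rfl
    · exact hb0
    · exact mo.trans _ _ _ hcb hb0
    · exact absurd rfl hj
  have h₂ := add_sq_sub_one_isStrictMax mo hbc hcb
  have hg₂ : ∀ d ∈ ((X b + X c) ^ 2 - 1 : MvPolynomial (Fin (1 + 2)) ℚ).support, d 0 = 0 := by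
    intro d hd
    rcases of_mem_support_add_sq_sub_one hd with rfl | rfl | rfl | rfl <;> simp [hb, hc]
  have hne₁ : linGen ≠ 0 := support_nonempty.1 ⟨_, h₁.1⟩
  have hG : IsRedGB mo (Ideal.span {linGen, (X b + X c) ^ 2 - 1})
      {linGen, (X b + X c) ^ 2 - 1} := by
    refine ⟨by simp, Ideal.subset_span, ?_, ?_, ?_⟩
    · rw [ltIdealO_span_pair h₁ h₂ (coeff_single_linGen 0) (coeff_single_add_sq_sub_one hbc)
        (X_sub_linGen 0) hg₂, Set.image_pair, leadTerm, leadTerm, leadExp_eq mo h₁,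
        leadExp_eq mo h₂, coeff_single_linGen 0, coeff_single_add_sq_sub_one hbc]
    · rintro g (rfl | rfl)
      · exact ⟨hne₁, by rw [leadExp_eq mo h₁, coeff_single_linGen]⟩
      · exact ⟨support_nonempty.1 ⟨_, h₂.1⟩,
          by rw [leadExp_eq mo h₂, coeff_single_add_sq_sub_one hbc]⟩
    · rintro g (rfl | rfl) g' (rfl | rfl) hne d hd hle
      · exact hne rfl
      · rw [leadExp_eq mo h₁] at hle
        simpa [hg₂ d hd] using hle 0
      · rw [leadExp_eq mo h₂] at hle
        obtain ⟨i, rfl⟩ := exists_of_mem_support_linGen hd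
        have := hle b
        by_cases hi : i = b <;> simp [hi] at this
      · exact hne rfl
  have hK : inKX 1 linGen := by
    refine hEO _ hG linGen (by simp) ((inKX_leadTerm_iff hne₁).2 fun i hi => ?_)
    rw [leadExp_eq mo h₁, Finsupp.single_eq_of_ne]
    rintro rfl
    simp at hi
  have := hK (Finsupp.single b 1) (by simp [coeff_single_linGen]) b
    (one_le_val hb)
  simp at this

lemma X_zero_notMem_ltIdealO {mo : MonoOrder (1 + 2)} {i : Fin (1 + 2)} (hi : i ≠ 0)
    (h : ∀ j, j ≠ i → mo.lt (Finsupp.single j 1) (Finsupp.single i 1)) :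
    X 0 ∉ ltIdealO mo (Ideal.span {linGen, X 0 ^ 2 - 1}) := by
  rw [ltIdealO_span_pair (linGen_isStrictMax fun j hj => not_not.2 (h j hj))
    (sq_sub_one_isStrictMax (not_not.2 (mo.zero_lt _ (by simp))))
    (coeff_single_linGen i) (coeff_single_sq_sub_one 0) (X_sub_linGen i)
    (sq_sub_one_apply_eq_zero hi), ← Set.image_pair (fun s => monomial s (1 : ℚ)),
    mem_ideal_span_monomial_image]
  intro hX
  obtain ⟨s, rfl | rfl, hs⟩ := hX (Finsupp.single 0 1) (by simp)
  · simpa [hi, hi.symm] using hs i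
  · simpa using hs 0

lemma not_isEV_of_lt {ω : Fin (1 + 2) → ℝ} (h₁ : ω 1 < ω 0) (h₂ : ω 2 < ω 0) :
    ¬ IsEV 1 (Ideal.span {linGen, X 0 ^ 2 - 1}) ω := by
  rintro ⟨-, mo, hEO, hω⟩
  have hopen : IsOpen {ω : Fin (1 + 2) → ℝ | ω 1 < ω 0 ∧ ω 2 < ω 0} :=
    (isOpen_lt (continuous_apply 1) (continuous_apply 0)).inter
      (isOpen_lt (continuous_apply 2) (continuous_apply 0))
  obtain ⟨ω', ⟨h₁', h₂'⟩, -, hω'⟩ := mem_closure_iff.1 hω _ hopen ⟨h₁, h₂⟩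
  have hX : X 0 ∈ ltIdealO mo (Ideal.span {linGen, X 0 ^ 2 - 1}) := by
    rw [← hω']
    refine Ideal.subset_span ⟨linGen, Ideal.subset_span (by simp), ?_⟩
    rw [initForm_eq (linGen_isStrictMax (i := 0) fun j hj => ?_), coeff_single_linGen, X]
    fin_cases j
    · exact absurd rfl hj
    · simpa using h₁'
    · simpa using h₂'
  have htot : ∀ i j : Fin (1 + 2), i ≠ j → mo.lt (Finsupp.single i 1) (Finsupp.single j 1) ∨
      mo.lt (Finsupp.single j 1) (Finsupp.single i 1) := fun i j hij =>
    (mo.total _ _).resolve_left fun h => hij (by simpa [Finsupp.single_left_inj] using h)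
  have hn : ∀ i : Fin (1 + 2), i ≠ 0 →
      ¬ ∀ j, j ≠ i → mo.lt (Finsupp.single j 1) (Finsupp.single i 1) :=
    fun i hi h => X_zero_notMem_ltIdealO hi h hX
  have hlin : linGen = X 0 + X 2 + X 1 := by rw [linGen]; ring
  rcases htot 1 2 (by decide) with h12 | h21
  · rcases htot 2 0 (by decide) with h20 | h02
    · exact not_isEO_of_lt (by decide) (by decide) (by decide) (by decide) hlin h20 h12 hEO
    · refine hn 2 (by decide) fun j hj => ?_
      fin_cases j
      exacts [h02, h12, absurd rfl hj]
  · rcases htot 1 0 (by decide) with h10 | h01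
    · exact not_isEO_of_lt (by decide) (by decide) (by decide) (by decide) rfl h10 h21 hEO
    · refine hn 1 (by decide) fun j hj => ?_
      fin_cases j
      exacts [h01, absurd rfl hj, h21]

/-- Non-convexity: for `I = ⟨x + u + v, x² - 1⟩ ⊆ ℚ[x,u,v]`, the weight
vectors `σ = (9,12,0)` and `τ = (9,0,10)` are `I`-specific elimination vectors but their
midpoint `ω = (9,6,5)` is not; hence the set of `I`-EVs (the union of the Gröbner cones of
all `I`-specific elimination orders) is not convex. -/
theorem EV_not_convex :
    IsEV 1 (Ideal.span {(X 0 : MvPolynomial (Fin (1 + 2)) ℚ) + X 1 + X 2, X 0 ^ 2 - 1})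
      ![9, 12, 0] ∧
    IsEV 1 (Ideal.span {(X 0 : MvPolynomial (Fin (1 + 2)) ℚ) + X 1 + X 2, X 0 ^ 2 - 1})
      ![9, 0, 10] ∧
    (![9, 6, 5] : Fin (1 + 2) → ℝ) =
      (1 / 2 : ℝ) • ![9, 12, 0] + (1 / 2 : ℝ) • ![9, 0, 10] ∧
    ¬ IsEV 1 (Ideal.span {(X 0 : MvPolynomial (Fin (1 + 2)) ℚ) + X 1 + X 2, X 0 ^ 2 - 1})
      ![9, 6, 5] ∧
    ¬ Convex ℝ {ω : Fin (1 + 2) → ℝ |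
      IsEV 1 (Ideal.span {(X 0 : MvPolynomial (Fin (1 + 2)) ℚ) + X 1 + X 2, X 0 ^ 2 - 1}) ω} := by
  have hσ : IsEV 1 (Ideal.span {linGen, X 0 ^ 2 - 1}) ![9, 12, 0] := by
    refine isEV_of_lt (b := 1) (c := 2) (by decide) (by decide) (by decide)
      (fun i => ?_) (by simp) ?_ (by simp)
    · fin_cases i <;> simp
    · norm_num
  have hτ : IsEV 1 (Ideal.span {linGen, X 0 ^ 2 - 1}) ![9, 0, 10] := by
    refine isEV_of_lt (b := 2) (c := 1) (by decide) (by decide) (by decide)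
      (fun i => ?_) (by simp) ?_ (by simp)
    · fin_cases i <;> simp
    · simp only [Matrix.cons_val]
      norm_num
  have hmid : (![9, 6, 5] : Fin (1 + 2) → ℝ) =
      (1 / 2 : ℝ) • ![9, 12, 0] + (1 / 2 : ℝ) • ![9, 0, 10] := by
    ext i
    fin_cases i <;> norm_num
  have hω : ¬ IsEV 1 (Ideal.span {linGen, X 0 ^ 2 - 1}) ![9, 6, 5] := by
    refine not_isEV_of_lt ?_ ?_ <;> simp only [Matrix.cons_val] <;> norm_num
  refine ⟨hσ, hτ, hmid, hω, fun hconv => hω ?_⟩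
  rw [hmid]
  exact hconv hσ hτ (by norm_num) (by norm_num) (by norm_num)
end

section
/- Let σ ∈ Ω = ℝ_{≥0}^{n+m} be a weight vector and τ ∈ Ω_u := {ω ∈ Ω : ω_1 = … = ω_n = 0}. Then for every ω on the segment [σ,τ] with ω ≠ τ (i.e., ω = tσ + (1−t)τ with t ∈ (0,1]) and all exponents α, γ ∈ ℕ^n and β ∈ ℕ^m: if deg_σ(x^α u^β) > deg_σ(x^γ), then deg_ω(x^α u^β) > deg_ω(x^γ). -/
open MvPolynomial

variable {N : ℕ} {K : Type*} [Field K]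

theorem wdeg_add (ω ω' : Fin N → ℝ) (d : Fin N → ℕ) :
    wdeg (ω + ω') d = wdeg ω d + wdeg ω' d := by
  simp [wdeg, add_mul, Finset.sum_add_distrib]

theorem wdeg_smul (c : ℝ) (ω : Fin N → ℝ) (d : Fin N → ℕ) :
    wdeg (c • ω) d = c * wdeg ω d := by
  simp [wdeg, mul_assoc, Finset.mul_sum]

theorem wdeg_nonneg {ω : Fin N → ℝ} (hω : ∀ i, 0 ≤ ω i) (d : Fin N → ℕ) : 0 ≤ wdeg ω d :=
  Finset.sum_nonneg fun i _ => mul_nonneg (hω i) (Nat.cast_nonneg _)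

theorem wdeg_append_zero_of_mem_OmegaU {n m : ℕ} {τ : Fin (n + m) → ℝ}
    (hτ : τ ∈ OmegaU n (n + m)) (γ : Fin n → ℕ) :
    wdeg τ (Fin.append γ (0 : Fin m → ℕ)) = 0 := by
  simp [wdeg, Fin.sum_univ_add, hτ.2]

/-- Let `σ ∈ Ω`, `τ ∈ Ω_u`, and `ω = tσ + (1-t)τ` with `t ∈ (0,1]`.
For exponents `α, γ ∈ ℕⁿ`, `β ∈ ℕᵐ`: if `deg_σ(x^α u^β) > deg_σ(x^γ)` then
`deg_ω(x^α u^β) > deg_ω(x^γ)`. -/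
theorem wdeg_gt_of_segment (n m : ℕ) (σ τ : Fin (n + m) → ℝ)
    (hσ : ∀ i, 0 ≤ σ i) (hτ : τ ∈ OmegaU n (n + m))
    (t : ℝ) (ht : t ∈ Set.Ioc (0 : ℝ) 1)
    (α γ : Fin n → ℕ) (β : Fin m → ℕ)
    (h : wdeg σ (Fin.append γ (0 : Fin m → ℕ)) < wdeg σ (Fin.append α β)) :
    wdeg (t • σ + (1 - t) • τ) (Fin.append γ (0 : Fin m → ℕ)) <
      wdeg (t • σ + (1 - t) • τ) (Fin.append α β) := by
  rw [wdeg_add, wdeg_add, wdeg_smul, wdeg_smul, wdeg_smul, wdeg_smul,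
    wdeg_append_zero_of_mem_OmegaU hτ, mul_zero, add_zero]
  exact lt_add_of_lt_of_nonneg (mul_lt_mul_of_pos_left h ht.1)
    (mul_nonneg (sub_nonneg.2 ht.2) (wdeg_nonneg hτ.1 _))
end
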